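/- Let A and B be ISM parameter matrices of g and h, respectively, on X. Define a_i = (U(A_i) + L(A_i))/2, b_i = (U(B_i) + L(B_i))/2, a = Σ_{i=1}^n a_i, b = Σ_{i=1}^n b_i, c = Σ_{i=1}^n a_i b_i, ω = (ab − c)/n, ρ_i(A) = (U(A_i) − L(A_i))/2, ρ_i(B) = (U(B_i) − L(B_i))/2, and R = (Σ_{i=1}^n ρ_i(A))·(Σ_{i=1}^n ρ_i(B)) − Σ_{i=1}^n ρ_i(A)ρ_i(B). Suppose C'_i^j = [C̲'_i^j, C̄'_i^j] are intervals such that (y + a − a_i)(z + b − b_i) − (a − a_i)(b − b_i) − ω ∈ C'_i^j for every y ∈ A_i^j and z ∈ B_i^j, for every i ∈ {1,…,n} and j ∈ {1,…,N}. Fix any k ∈ {1,…,n} and define C_k^j = C'_k^j + [−R, R] for all j and C_i^j = C'_i^j for i ≠ k. Then C is an ISM parameter matrix of the product g·h on X, i.e., for every multi-index j ∈ {1,…,N}^n and every x ∈ Ξ^j, Σ_{i=1}^n C̲_i^{j_i} ≤ g(x)h(x) ≤ Σ_{i=1}^n C̄_i^{j_i}. -/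

import Mathlib

/-- `x` lies in the grid box `Ξ^j = ∏_i X_i^{j i}` of the uniform `N`-partition of
`∏_i [xl i, xu i]` (0-based indexing of the `N` subintervals). -/
def InGridBox {n N : ℕ} (xl xu : Fin n → ℝ) (j : Fin n → Fin N) (x : Fin n → ℝ) : Prop :=
  ∀ i, xl i + (j i : ℝ) * ((xu i - xl i) / N) ≤ x i ∧
       x i ≤ xl i + ((j i : ℝ) + 1) * ((xu i - xl i) / N)

/-- `(Al, Au)` is an interval superposition model (ISM) parameter matrix of `f` on
`X = ∏_i [xl i, xu i]`. -/
def IsISM {n N : ℕ} (xl xu : Fin n → ℝ) (Al Au : Fin n → Fin N → ℝ)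
    (f : (Fin n → ℝ) → ℝ) : Prop :=
  ∀ j : Fin n → Fin N, ∀ x : Fin n → ℝ, InGridBox xl xu j x →
    (∑ i, Al i (j i)) ≤ f x ∧ f x ≤ ∑ i, Au i (j i)

/-- Any number between the sums of the endpoints of finitely many intervals is a sum of points of
these intervals. -/
theorem exists_sum_eq_of_sum_le_of_le_sum {ι : Type*} [Fintype ι] {l u : ι → ℝ}
    (hlu : ∀ i, l i ≤ u i) {s : ℝ} (hl : ∑ i, l i ≤ s) (hu : s ≤ ∑ i, u i) :
    ∃ y : ι → ℝ, (∀ i, l i ≤ y i ∧ y i ≤ u i) ∧ ∑ i, y i = s := by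
  have hs : s ∈ segment ℝ (∑ i, l i) (∑ i, u i) := by
    rw [segment_eq_Icc (hl.trans hu)]
    exact ⟨hl, hu⟩
  obtain ⟨p, q, hp, hq, hpq, rfl⟩ := hs
  obtain rfl : p = 1 - q := by linarith
  refine ⟨fun i => (1 - q) * l i + q * u i, fun i => ⟨?_, ?_⟩, ?_⟩
  · nlinarith [hlu i]
  · nlinarith [hlu i]
  · simp only [Finset.sum_add_distrib, ← Finset.mul_sum, smul_eq_mul]

/-- The off-diagonal part of a product of two sums. -/
theorem sum_mul_sum_sub_sum_mul {ι : Type*} [Fintype ι] [DecidableEq ι] (d e : ι → ℝ) :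
    (∑ i, d i) * (∑ i, e i) - ∑ i, d i * e i =
      ∑ i, d i * ∑ j ∈ Finset.univ.erase i, e j := by
  simp only [Finset.sum_mul, ← Finset.sum_sub_distrib]
  refine Finset.sum_congr rfl fun i _ => ?_
  rw [← Finset.add_sum_erase _ e (Finset.mem_univ i)]
  ring

theorem abs_sum_mul_sum_sub_sum_mul_le {ι : Type*} [Fintype ι] [DecidableEq ι]
    {d e r s : ι → ℝ} (hd : ∀ i, |d i| ≤ r i) (he : ∀ i, |e i| ≤ s i) :
    |(∑ i, d i) * (∑ i, e i) - ∑ i, d i * e i| ≤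
      (∑ i, r i) * (∑ i, s i) - ∑ i, r i * s i := by
  rw [sum_mul_sum_sub_sum_mul, sum_mul_sum_sub_sum_mul]
  refine (Finset.abs_sum_le_sum_abs _ _).trans (Finset.sum_le_sum fun i _ => ?_)
  rw [abs_mul]
  exact mul_le_mul (hd i)
    ((Finset.abs_sum_le_sum_abs _ _).trans (Finset.sum_le_sum fun j _ => he j))
    (abs_nonneg _) ((abs_nonneg _).trans (hd i))

/-- Summing the centered products recovers the product of the sums up to off-diagonal terms. -/
theorem sum_centered_mul_eq {n : ℕ} [NeZero n] (y z p q : Fin n → ℝ) :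
    ∑ i, ((y i + ∑ m, p m - p i) * (z i + ∑ m, q m - q i)
        - (∑ m, p m - p i) * (∑ m, q m - q i)
        - ((∑ m, p m) * (∑ m, q m) - ∑ m, p m * q m) / n) =
      (∑ i, y i) * (∑ i, z i)
        - ((∑ i, (y i - p i)) * (∑ i, (z i - q i)) - ∑ i, (y i - p i) * (z i - q i)) := by
  have hn : (n : ℝ) ≠ 0 := NeZero.ne _
  generalize ha : ∑ m, p m = a
  generalize hb : ∑ m, q m = b
  have h : ∀ i, (y i + a - p i) * (z i + b - q i) - (a - p i) * (b - q i)
      - (a * b - ∑ m, p m * q m) / n =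
      (y i - p i) * (z i - q i) + a * z i + b * y i - p i * q i
        - (a * b - ∑ m, p m * q m) / n := fun i => by ring
  simp only [h, Finset.sum_sub_distrib, Finset.sum_add_distrib, ← Finset.mul_sum, ha, hb,
    Finset.sum_const, Finset.card_univ, Fintype.card_fin, nsmul_eq_mul, mul_div_cancel₀ _ hn]
  field_simp
  ring

theorem abs_sub_midpoint_le {l u x : ℝ} (hl : l ≤ x) (hu : x ≤ u) :
    |x - (u + l) / 2| ≤ (u - l) / 2 := by
  rw [abs_le]
  constructor <;> linarith

/-- Soundness of the product rule of interval superposition arithmetic. -/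
theorem ism_product_rule
    (n N : ℕ) [NeZero n] [NeZero N]
    (xl xu : Fin n → ℝ)
    (Al Au Bl Bu : Fin n → Fin N → ℝ)
    (hAle : ∀ i j, Al i j ≤ Au i j) (hBle : ∀ i j, Bl i j ≤ Bu i j)
    (g h : (Fin n → ℝ) → ℝ)
    (hA : IsISM xl xu Al Au g) (hB : IsISM xl xu Bl Bu h)
    (LA UA LB UB : Fin n → ℝ)
    (hLA : ∀ i, LA i = Finset.univ.inf' Finset.univ_nonempty (Al i))
    (hUA : ∀ i, UA i = Finset.univ.sup' Finset.univ_nonempty (Au i))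
    (hLB : ∀ i, LB i = Finset.univ.inf' Finset.univ_nonempty (Bl i))
    (hUB : ∀ i, UB i = Finset.univ.sup' Finset.univ_nonempty (Bu i))
    (av bv : Fin n → ℝ)
    (hav : ∀ i, av i = (UA i + LA i) / 2) (hbv : ∀ i, bv i = (UB i + LB i) / 2)
    (a b c ω : ℝ)
    (ha : a = ∑ i, av i) (hb : b = ∑ i, bv i) (hc : c = ∑ i, av i * bv i)
    (hω : ω = (a * b - c) / n)
    (ρA ρB : Fin n → ℝ)
    (hρA : ∀ i, ρA i = (UA i - LA i) / 2) (hρB : ∀ i, ρB i = (UB i - LB i) / 2)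
    (R : ℝ)
    (hR : R = (∑ i, ρA i) * (∑ i, ρB i) - ∑ i, ρA i * ρB i)
    (C'l C'u : Fin n → Fin N → ℝ)
    (hC' : ∀ i j, ∀ y z : ℝ, Al i j ≤ y → y ≤ Au i j → Bl i j ≤ z → z ≤ Bu i j →
      C'l i j ≤ (y + a - av i) * (z + b - bv i) - (a - av i) * (b - bv i) - ω ∧
      (y + a - av i) * (z + b - bv i) - (a - av i) * (b - bv i) - ω ≤ C'u i j)
    (k : Fin n)
    (Cl Cu : Fin n → Fin N → ℝ)
    (hCk : ∀ j, Cl k j = C'l k j - R ∧ Cu k j = C'u k j + R)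
    (hCi : ∀ i, i ≠ k → ∀ j, Cl i j = C'l i j ∧ Cu i j = C'u i j) :
    IsISM xl xu Cl Cu (fun x => g x * h x) := by
  intro j x hx
  obtain ⟨y, hy, hyg⟩ :=
    exists_sum_eq_of_sum_le_of_le_sum (fun i => hAle i (j i)) (hA j x hx).1 (hA j x hx).2
  obtain ⟨z, hz, hzh⟩ :=
    exists_sum_eq_of_sum_le_of_le_sum (fun i => hBle i (j i)) (hB j x hx).1 (hB j x hx).2
  have hd : ∀ i, |y i - av i| ≤ ρA i := fun i => by
    rw [hav, hρA]
    refine abs_sub_midpoint_le (le_trans ?_ (hy i).1) ((hy i).2.trans ?_)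
    · rw [hLA]; exact Finset.inf'_le _ (Finset.mem_univ _)
    · rw [hUA]; exact Finset.le_sup' _ (Finset.mem_univ _)
  have he : ∀ i, |z i - bv i| ≤ ρB i := fun i => by
    rw [hbv, hρB]
    refine abs_sub_midpoint_le (le_trans ?_ (hz i).1) ((hz i).2.trans ?_)
    · rw [hLB]; exact Finset.inf'_le _ (Finset.mem_univ _)
    · rw [hUB]; exact Finset.le_sup' _ (Finset.mem_univ _)
  have hrem := abs_le.1 (abs_sum_mul_sum_sub_sum_mul_le hd he)
  rw [← hR] at hrem
  have hsum := sum_centered_mul_eq y z av bv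
  rw [← ha, ← hb, ← hc, ← hω, hyg, hzh] at hsum
  have hC i := hC' i (j i) (y i) (z i) (hy i).1 (hy i).2 (hz i).1 (hz i).2
  have hlow := Finset.sum_le_sum fun i (_ : i ∈ Finset.univ) => (hC i).1
  have hupp := Finset.sum_le_sum fun i (_ : i ∈ Finset.univ) => (hC i).2
  have hCl : ∑ i, Cl i (j i) = ∑ i, C'l i (j i) - R := by
    rw [← Finset.add_sum_erase _ _ (Finset.mem_univ k), (hCk _).1,
      Finset.sum_congr rfl fun i hi => (hCi i (Finset.ne_of_mem_erase hi) (j i)).1,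
      ← Finset.add_sum_erase _ (fun i => C'l i (j i)) (Finset.mem_univ k)]
    ring
  have hCu : ∑ i, Cu i (j i) = ∑ i, C'u i (j i) + R := by
    rw [← Finset.add_sum_erase _ _ (Finset.mem_univ k), (hCk _).2,
      Finset.sum_congr rfl fun i hi => (hCi i (Finset.ne_of_mem_erase hi) (j i)).2,
      ← Finset.add_sum_erase _ (fun i => C'u i (j i)) (Finset.mem_univ k)]
    ring
  rw [hCl, hCu]
  constructor <;> linarith [hrem.1, hrem.2]
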